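/- arXiv:1007.5295 — 4 statements merged into one kernel-verified Lean document; each statement's English description precedes it below -/
import Mathlib

section
/- The function δ₂(τ) = −(1/8)(θ₁(0,τ)⁴ + θ₃(0,τ)⁴) is a modular form of weight 2 over Γ⁰(2) with trivial character: it is holomorphic on the upper half-plane ℍ, satisfies δ₂((aτ+b)/(cτ+d)) = (cτ+d)² δ₂(τ) for every matrix (a b; c d) ∈ Γ⁰(2) and τ ∈ ℍ, and for every γ ∈ SL₂(ℤ) the weight-2 slash translate of δ₂ by γ is bounded as Im τ → ∞. -/
open Complex

noncomputable section

/-- `q^s = e^{2πisτ}`. -/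
def qpow (s τ : ℂ) : ℂ := Complex.exp (2 * (Real.pi : ℂ) * Complex.I * s * τ)

/-- The Jacobi theta function `θ(v, τ)`, defined by its infinite product. -/
def jTheta (v τ : ℂ) : ℂ :=
  2 * qpow (1/8) τ * Complex.sin ((Real.pi : ℂ) * v) *
    ∏' j : ℕ, ((1 - qpow ((j : ℂ) + 1) τ)
      * (1 - Complex.exp (2 * (Real.pi : ℂ) * Complex.I * v) * qpow ((j : ℂ) + 1) τ)
      * (1 - Complex.exp (-(2 * (Real.pi : ℂ) * Complex.I * v)) * qpow ((j : ℂ) + 1) τ))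

/-- The Jacobi theta function `θ₁(v, τ)`, defined by its infinite product. -/
def jTheta1 (v τ : ℂ) : ℂ :=
  2 * qpow (1/8) τ * Complex.cos ((Real.pi : ℂ) * v) *
    ∏' j : ℕ, ((1 - qpow ((j : ℂ) + 1) τ)
      * (1 + Complex.exp (2 * (Real.pi : ℂ) * Complex.I * v) * qpow ((j : ℂ) + 1) τ)
      * (1 + Complex.exp (-(2 * (Real.pi : ℂ) * Complex.I * v)) * qpow ((j : ℂ) + 1) τ))

/-- The Jacobi theta function `θ₂(v, τ)`, defined by its infinite product
(the `j`-th factor involves `q^{j+1-1/2}`). -/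
def jTheta2 (v τ : ℂ) : ℂ :=
  ∏' j : ℕ, ((1 - qpow ((j : ℂ) + 1) τ)
    * (1 - Complex.exp (2 * (Real.pi : ℂ) * Complex.I * v) * qpow ((j : ℂ) + 1/2) τ)
    * (1 - Complex.exp (-(2 * (Real.pi : ℂ) * Complex.I * v)) * qpow ((j : ℂ) + 1/2) τ))

/-- The Jacobi theta function `θ₃(v, τ)`, defined by its infinite product. -/
def jTheta3 (v τ : ℂ) : ℂ :=
  ∏' j : ℕ, ((1 - qpow ((j : ℂ) + 1) τ)
    * (1 + Complex.exp (2 * (Real.pi : ℂ) * Complex.I * v) * qpow ((j : ℂ) + 1/2) τ)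
    * (1 + Complex.exp (-(2 * (Real.pi : ℂ) * Complex.I * v)) * qpow ((j : ℂ) + 1/2) τ))

/-- `θ'(0, τ)`: the partial derivative of `θ(v, τ)` in `v`, evaluated at `v = 0`. -/
def jThetaDeriv (τ : ℂ) : ℂ := deriv (fun v => jTheta v τ) 0

/-- `δ₂(τ) = -(1/8)(θ₁(0,τ)⁴ + θ₃(0,τ)⁴)`. -/
def delta2 (τ : ℂ) : ℂ := -(1/8) * (jTheta1 0 τ ^ 4 + jTheta3 0 τ ^ 4)

open UpperHalfPlane hiding I
open ModularForm Matrix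
open scoped MatrixGroups

/-- The Euler product `∏_{n ≥ 1} (1 - x^n)`. -/
def eulerProd (x : ℂ) : ℂ := ∏' n : ℕ, (1 - x ^ (n + 1))

/-- The product `∏_{n ≥ 0} (1 - x^{2n+1})` over odd exponents. -/
def oddEulerProd (x : ℂ) : ℂ := ∏' n : ℕ, (1 - x ^ (2 * n + 1))

lemma norm_sq_lt_one {x : ℂ} (hx : ‖x‖ < 1) : ‖x ^ 2‖ < 1 := by
  rw [norm_pow]
  exact pow_lt_one₀ (norm_nonneg x) hx two_ne_zero

lemma multipliable_one_sub_pow_odd {x : ℂ} (hx : ‖x‖ < 1) :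
    Multipliable fun n : ℕ ↦ 1 - x ^ (2 * n + 1) := by
  have h : Summable fun n : ℕ ↦ ‖-x ^ (2 * n + 1)‖ := by
    simpa [Function.comp_def] using
      (summable_geometric_of_lt_one (norm_nonneg x) hx).comp_injective
      (i := fun n : ℕ ↦ 2 * n + 1) (fun a b h ↦ by simpa using h)
  simpa [sub_eq_add_neg] using multipliable_one_add_of_summable h

lemma eulerProd_ne_zero {x : ℂ} (hx : ‖x‖ < 1) : eulerProd x ≠ 0 := by
  have h := tprod_one_add_ne_zero_of_summable (f := fun n : ℕ ↦ -x ^ (n + 1)) (fun n h ↦ ?_) ?_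
  · simpa [eulerProd, sub_eq_add_neg] using h
  · have h1 : x ^ (n + 1) = 1 := by linear_combination -h
    have h2 : ‖x ^ (n + 1)‖ < 1 := by
      rw [norm_pow]
      exact pow_lt_one₀ (norm_nonneg x) hx n.succ_ne_zero
    simp [h1] at h2
  · simpa using (summable_nat_add_iff 1).mpr (summable_geometric_of_lt_one (norm_nonneg _) hx)

lemma differentiableOn_eulerProd : DifferentiableOn ℂ eulerProd (Metric.ball 0 1) :=
  differentiableOn_tprod_one_sub_pow

lemma eulerProd_eq_mul_oddEulerProd {x : ℂ} (hx : ‖x‖ < 1) :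
    eulerProd x = oddEulerProd x * eulerProd (x ^ 2) := by
  have he : (fun k : ℕ ↦ 1 - (x ^ 2) ^ (k + 1)) = fun k ↦ 1 - x ^ (2 * k + 1 + 1) := by
    funext k
    rw [← pow_mul]
    ring_nf
  have hm := multipliable_one_sub_pow (norm_sq_lt_one hx)
  rw [he] at hm
  rw [eulerProd, eulerProd, oddEulerProd, he]
  exact (tprod_even_mul_odd (f := fun n : ℕ ↦ 1 - x ^ (n + 1))
    (multipliable_one_sub_pow_odd hx) hm).symm

lemma oddEulerProd_mul_neg {x : ℂ} (hx : ‖x‖ < 1) :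
    oddEulerProd x * oddEulerProd (-x) = oddEulerProd (x ^ 2) := by
  rw [oddEulerProd, oddEulerProd, oddEulerProd, ← (multipliable_one_sub_pow_odd hx).tprod_mul
    (multipliable_one_sub_pow_odd (by simpa using hx))]
  refine tprod_congr fun n ↦ ?_
  rw [Odd.neg_pow ⟨n, rfl⟩, ← pow_mul, mul_comm 2 (2 * n + 1), pow_mul]
  ring

lemma eulerProd_mul_neg_mul {x : ℂ} (hx : ‖x‖ < 1) :
    eulerProd x * eulerProd (-x) * eulerProd (x ^ 4) = eulerProd (x ^ 2) ^ 3 := by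
  have h1 := eulerProd_eq_mul_oddEulerProd hx
  have h2 := eulerProd_eq_mul_oddEulerProd (x := -x) (by simpa using hx)
  have h3 := eulerProd_eq_mul_oddEulerProd (norm_sq_lt_one hx)
  have h4 := oddEulerProd_mul_neg hx
  rw [neg_sq] at h2
  rw [← pow_mul] at h3
  norm_num at h3
  rw [h1, h2]
  linear_combination eulerProd (x ^ 2) ^ 2 * eulerProd (x ^ 4) * h4 - eulerProd (x ^ 2) ^ 2 * h3

lemma tprod_one_sub_mul_one_add_sq {x : ℂ} (hx : ‖x‖ < 1) :
    ∏' n : ℕ, ((1 - x ^ (n + 1)) * (1 + x ^ (n + 1)) * (1 + x ^ (n + 1))) =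
      eulerProd (x ^ 2) ^ 2 / eulerProd x := by
  have h1 : Multipliable fun n : ℕ ↦ 1 + x ^ (n + 1) := by
    refine multipliable_one_add_of_summable ?_
    simpa using (summable_nat_add_iff 1).mpr (summable_geometric_of_lt_one (norm_nonneg _) hx)
  have h2 := multipliable_one_sub_pow hx
  have h3 : eulerProd x * ∏' n : ℕ, (1 + x ^ (n + 1)) = eulerProd (x ^ 2) := by
    rw [eulerProd, eulerProd, ← h2.tprod_mul h1]
    refine tprod_congr fun n ↦ ?_
    rw [← pow_mul, mul_comm 2, pow_mul]
    ring
  rw [(h2.mul h1).tprod_mul h1, h2.tprod_mul h1, eq_div_iff (eulerProd_ne_zero hx), ← h3]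
  simp only [eulerProd]
  ring

lemma tprod_one_sub_even_mul_one_sub_odd_sq {x : ℂ} (hx : ‖x‖ < 1) :
    ∏' n : ℕ, ((1 - (x ^ 2) ^ (n + 1)) * (1 - x ^ (2 * n + 1)) * (1 - x ^ (2 * n + 1))) =
      eulerProd x ^ 2 / eulerProd (x ^ 2) := by
  have h1 := multipliable_one_sub_pow_odd hx
  have h2 := multipliable_one_sub_pow (norm_sq_lt_one hx)
  rw [(h2.mul h1).tprod_mul h1, h2.tprod_mul h1,
    eq_div_iff (eulerProd_ne_zero (norm_sq_lt_one hx)), eulerProd_eq_mul_oddEulerProd hx]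
  simp only [eulerProd, oddEulerProd]
  ring

/-- The nome `e^{πiτ}`. -/
def nome (τ : ℂ) : ℂ := cexp (Real.pi * I * τ)

lemma norm_nome (τ : ℂ) : ‖nome τ‖ = Real.exp (-(Real.pi * τ.im)) := by
  simp [nome, Complex.norm_exp]

lemma norm_nome_lt_one {τ : ℂ} (hτ : 0 < τ.im) : ‖nome τ‖ < 1 := by
  rw [norm_nome, Real.exp_lt_one_iff]
  have := mul_pos Real.pi_pos hτ
  linarith

lemma nome_add_one (τ : ℂ) : nome (τ + 1) = -nome τ := by
  simp [nome, mul_add, Complex.exp_add, Complex.exp_pi_mul_I]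

lemma qpow_natCast_add_one (n : ℕ) (τ : ℂ) : qpow ((n : ℂ) + 1) τ = (nome τ ^ 2) ^ (n + 1) := by
  rw [qpow, nome, ← Complex.exp_nat_mul, ← Complex.exp_nat_mul]
  congr 1
  push_cast
  ring

lemma qpow_natCast_add_half (n : ℕ) (τ : ℂ) :
    qpow ((n : ℂ) + 1 / 2) τ = nome τ ^ (2 * n + 1) := by
  rw [qpow, nome, ← Complex.exp_nat_mul]
  congr 1
  push_cast
  ring

lemma qpow_eighth_pow_four (τ : ℂ) : qpow (1 / 8) τ ^ 4 = nome τ := by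
  rw [qpow, nome, ← Complex.exp_nat_mul]
  congr 1
  push_cast
  ring

/-- `θ₁(0, τ)⁴` as a function of the nome. -/
def theta1Fourth (x : ℂ) : ℂ := 16 * x * eulerProd (x ^ 4) ^ 8 / eulerProd (x ^ 2) ^ 4

/-- `θ₂(0, τ)⁴` as a function of the nome. -/
def theta2Fourth (x : ℂ) : ℂ := eulerProd x ^ 8 / eulerProd (x ^ 2) ^ 4

/-- `θ₃(0, τ)⁴` as a function of the nome. -/
def theta3Fourth (x : ℂ) : ℂ := eulerProd (-x) ^ 8 / eulerProd (x ^ 2) ^ 4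

lemma jTheta1_zero_pow_four {τ : ℂ} (hτ : 0 < τ.im) :
    jTheta1 0 τ ^ 4 = theta1Fourth (nome τ) := by
  have h := tprod_one_sub_mul_one_add_sq (norm_sq_lt_one (norm_nome_lt_one hτ))
  simp only [jTheta1, mul_zero, Complex.cos_zero, Complex.exp_zero, neg_zero, one_mul, mul_one,
    qpow_natCast_add_one]
  rw [h, mul_pow, mul_pow, qpow_eighth_pow_four, theta1Fourth, ← pow_mul]
  ring

lemma jTheta3_zero_pow_four {τ : ℂ} (hτ : 0 < τ.im) :
    jTheta3 0 τ ^ 4 = theta3Fourth (nome τ) := by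
  have h := tprod_one_sub_even_mul_one_sub_odd_sq (x := -nome τ)
    (by simpa using norm_nome_lt_one hτ)
  simp only [neg_sq, Odd.neg_pow ⟨_, rfl⟩, sub_neg_eq_add] at h
  simp only [jTheta3, mul_zero, Complex.exp_zero, neg_zero, one_mul,
    qpow_natCast_add_one, qpow_natCast_add_half]
  rw [h, theta3Fourth]
  ring

lemma delta2_eq {τ : ℂ} (hτ : 0 < τ.im) :
    delta2 τ = -(1 / 8) * (theta1Fourth (nome τ) + theta3Fourth (nome τ)) := by
  rw [delta2, jTheta1_zero_pow_four hτ, jTheta3_zero_pow_four hτ]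

lemma differentiableOn_eulerProd_comp {g : ℂ → ℂ} (hg : Differentiable ℂ g)
    (h : ∀ x, ‖x‖ < 1 → ‖g x‖ < 1) :
    DifferentiableOn ℂ (fun x ↦ eulerProd (g x)) (Metric.ball 0 1) :=
  differentiableOn_eulerProd.comp hg.differentiableOn fun x hx ↦ by
    simpa using h x (by simpa using hx)

lemma differentiableOn_eulerProd_sq :
    DifferentiableOn ℂ (fun x ↦ eulerProd (x ^ 2)) (Metric.ball 0 1) :=
  differentiableOn_eulerProd_comp (by fun_prop) fun _ ↦ norm_sq_lt_one

lemma eulerProd_sq_pow_four_ne_zero {x : ℂ} (hx : x ∈ Metric.ball (0 : ℂ) 1) :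
    eulerProd (x ^ 2) ^ 4 ≠ 0 :=
  pow_ne_zero 4 (eulerProd_ne_zero (norm_sq_lt_one (by simpa using hx)))

lemma differentiableOn_theta1Fourth : DifferentiableOn ℂ theta1Fourth (Metric.ball 0 1) := by
  have h : DifferentiableOn ℂ (fun x ↦ eulerProd (x ^ 4)) (Metric.ball 0 1) :=
    differentiableOn_eulerProd_comp (by fun_prop) fun x hx ↦ by
      simpa [← pow_mul] using norm_sq_lt_one (norm_sq_lt_one hx)
  exact ((differentiableOn_id.const_mul 16).mul (h.fun_pow 8)).div
    (differentiableOn_eulerProd_sq.fun_pow 4) fun x hx ↦ eulerProd_sq_pow_four_ne_zero hx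

lemma differentiableOn_theta2Fourth : DifferentiableOn ℂ theta2Fourth (Metric.ball 0 1) :=
  (differentiableOn_eulerProd.fun_pow 8).div
    (differentiableOn_eulerProd_sq.fun_pow 4) fun _ hx ↦ eulerProd_sq_pow_four_ne_zero hx

lemma differentiableOn_theta3Fourth : DifferentiableOn ℂ theta3Fourth (Metric.ball 0 1) := by
  have h : DifferentiableOn ℂ (fun x ↦ eulerProd (-x)) (Metric.ball 0 1) :=
    differentiableOn_eulerProd_comp (by fun_prop) fun x hx ↦ by simpa using hx
  exact (h.fun_pow 8).div
    (differentiableOn_eulerProd_sq.fun_pow 4) fun _ hx ↦ eulerProd_sq_pow_four_ne_zero hx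

lemma theta1Fourth_neg (x : ℂ) : theta1Fourth (-x) = -theta1Fourth x := by
  rw [theta1Fourth, theta1Fourth, Even.neg_pow (by decide), Even.neg_pow (by decide)]
  ring

lemma theta2Fourth_neg (x : ℂ) : theta2Fourth (-x) = theta3Fourth x := by
  rw [theta2Fourth, theta3Fourth, neg_sq]

lemma theta3Fourth_neg (x : ℂ) : theta3Fourth (-x) = theta2Fourth x := by
  rw [theta2Fourth, theta3Fourth, neg_sq, neg_neg]

lemma eta_eq (z : ℂ) : η z = cexp (2 * Real.pi * I * z / 24) * eulerProd (nome z ^ 2) := by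
  have h : Function.Periodic.qParam 1 z = nome z ^ 2 := by
    rw [nome, Function.Periodic.qParam, ← Complex.exp_nat_mul]
    congr 1
    push_cast
    ring
  simp only [ModularForm.eta, eta_q, h, eulerProd]
  simp [Function.Periodic.qParam]

lemma eta_neg_inv_pow_four {z : ℂ} (hz : 0 < z.im) : η (-1 / z) ^ 4 = -z ^ 2 * η z ^ 4 := by
  have hsqrt : ∀ w : ℂ, w ≠ 0 → Complex.sqrt w ^ 4 = w ^ 2 := fun w hw ↦ by
    rw [_root_.sqrt_eq_exp hw, ← Complex.exp_nat_mul,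
      show ((4 : ℕ) : ℂ) * (Complex.log w / 2) = (2 : ℕ) * Complex.log w by push_cast; ring,
      Complex.exp_nat_mul, Complex.exp_log hw]
  have hz0 : z ≠ 0 := fun h ↦ by simp [h] at hz
  have h := eta_comp_eq_csqrt_I_inv hz
  simp only [Function.comp_apply, Pi.smul_apply, Pi.mul_apply, smul_eq_mul] at h
  rw [h, mul_pow, mul_pow, inv_pow, hsqrt _ I_ne_zero, hsqrt _ hz0, I_sq]
  ring

lemma theta1Fourth_nome (z : ℂ) :
    theta1Fourth (nome z) = 16 * η (2 * z) ^ 8 / η z ^ 4 := by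
  have h1 : nome (2 * z) ^ 2 = nome z ^ 4 := by
    rw [nome, nome, ← Complex.exp_nat_mul, ← Complex.exp_nat_mul]
    congr 1
    push_cast
    ring
  have h2 : cexp (2 * Real.pi * I * (2 * z) / 24) ^ 8 =
      nome z * cexp (2 * Real.pi * I * z / 24) ^ 4 := by
    rw [nome, ← Complex.exp_nat_mul, ← Complex.exp_nat_mul, ← Complex.exp_add]
    congr 1
    push_cast
    ring
  have h3 := Complex.exp_ne_zero (2 * Real.pi * I * z / 24)
  rw [eta_eq, eta_eq, h1, mul_pow, mul_pow, h2, theta1Fourth]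
  field_simp

lemma theta2Fourth_nome (z : ℂ) :
    theta2Fourth (nome z) = η (z / 2) ^ 8 / η z ^ 4 := by
  have h1 : nome (z / 2) ^ 2 = nome z := by
    rw [nome, nome, ← Complex.exp_nat_mul]
    congr 1
    push_cast
    ring
  have h2 : cexp (2 * Real.pi * I * (z / 2) / 24) ^ 8 =
      cexp (2 * Real.pi * I * z / 24) ^ 4 := by
    rw [← Complex.exp_nat_mul, ← Complex.exp_nat_mul]
    congr 1
    push_cast
    ring
  have h3 := Complex.exp_ne_zero (2 * Real.pi * I * z / 24)
  rw [eta_eq, eta_eq, h1, mul_pow, mul_pow, h2, theta2Fourth]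
  field_simp

lemma theta1Fourth_mul_theta2Fourth_mul_theta3Fourth {z : ℂ} (hz : 0 < z.im) :
    theta1Fourth (nome z) * theta2Fourth (nome z) * theta3Fourth (nome z) = 16 * η z ^ 12 := by
  have h0 := eulerProd_ne_zero (norm_sq_lt_one (norm_nome_lt_one hz))
  have h1 : cexp (2 * Real.pi * I * z / 24) ^ 12 = nome z := by
    rw [nome, ← Complex.exp_nat_mul]
    congr 1
    push_cast
    ring
  have h2 : (eulerProd (nome z) * eulerProd (-nome z) * eulerProd (nome z ^ 4)) ^ 8 =
      (eulerProd (nome z ^ 2) ^ 3) ^ 8 := by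
    rw [eulerProd_mul_neg_mul (norm_nome_lt_one hz)]
  rw [eta_eq, mul_pow, h1, theta1Fourth, theta2Fourth, theta3Fourth]
  field_simp
  linear_combination nome z * h2

lemma im_neg_one_div_pos {z : ℂ} (hz : 0 < z.im) : 0 < (-1 / z).im := by
  have h := UpperHalfPlane.im_inv_neg_coe_pos ⟨z, hz⟩
  rwa [inv_neg, ← one_div, ← neg_div] at h

lemma theta1Fourth_nome_neg_inv {z : ℂ} (hz : 0 < z.im) :
    theta1Fourth (nome (-1 / z)) = -z ^ 2 * theta2Fourth (nome z) := by
  have hz0 : z ≠ 0 := fun h ↦ by simp [h] at hz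
  have he := eta_ne_zero (z := z) hz
  have h1 := eta_neg_inv_pow_four (z := z / 2) (by simpa using hz)
  rw [theta1Fourth_nome, theta2Fourth_nome, show 2 * (-1 / z) = -1 / (z / 2) by field_simp,
    show η (-1 / (z / 2)) ^ 8 = (η (-1 / (z / 2)) ^ 4) ^ 2 by ring, h1, eta_neg_inv_pow_four hz]
  field_simp
  ring

lemma theta2Fourth_nome_neg_inv {z : ℂ} (hz : 0 < z.im) :
    theta2Fourth (nome (-1 / z)) = -z ^ 2 * theta1Fourth (nome z) := by
  have hz0 : z ≠ 0 := fun h ↦ by simp [h] at hz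
  have he := eta_ne_zero (z := z) hz
  have h1 := eta_neg_inv_pow_four (z := 2 * z) (by simpa using hz)
  rw [theta1Fourth_nome, theta2Fourth_nome, show -1 / z / 2 = -1 / (2 * z) by field_simp,
    show η (-1 / (2 * z)) ^ 8 = (η (-1 / (2 * z)) ^ 4) ^ 2 by ring, h1, eta_neg_inv_pow_four hz]
  field_simp
  ring

lemma theta3Fourth_nome_neg_inv {z : ℂ} (hz : 0 < z.im) :
    theta3Fourth (nome (-1 / z)) = -z ^ 2 * theta3Fourth (nome z) := by
  have hz0 : z ≠ 0 := fun h ↦ by simp [h] at hz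
  have h1 := theta1Fourth_mul_theta2Fourth_mul_theta3Fourth (im_neg_one_div_pos hz)
  have h2 := theta1Fourth_mul_theta2Fourth_mul_theta3Fourth hz
  have h3 : 16 * η z ^ 12 ≠ 0 := mul_ne_zero (by norm_num) (pow_ne_zero _ (eta_ne_zero hz))
  rw [theta1Fourth_nome_neg_inv hz, theta2Fourth_nome_neg_inv hz,
    show η (-1 / z) ^ 12 = (η (-1 / z) ^ 4) ^ 3 by ring, eta_neg_inv_pow_four hz] at h1
  rw [← h2] at h3
  have h4 : z ^ 4 * (theta1Fourth (nome z) * theta2Fourth (nome z)) ≠ 0 :=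
    mul_ne_zero (pow_ne_zero _ hz0) (left_ne_zero_of_mul h3)
  refine mul_left_cancel₀ h4 ?_
  linear_combination h1 + z ^ 6 * h2

/-- The three weight two forms `θ₁⁴ + θ₃⁴`, `θ₂⁴ - θ₁⁴`, `-(θ₂⁴ + θ₃⁴)` as functions of the nome,
indexed by the nonzero row vectors modulo `2`. -/
def thetaForm (v : Fin 2 → ZMod 2) (x : ℂ) : ℂ :=
  if v = ![1, 0] then theta1Fourth x + theta3Fourth x
  else if v = ![1, 1] then theta2Fourth x - theta1Fourth x
  else if v = ![0, 1] then -(theta2Fourth x + theta3Fourth x)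
  else 0

lemma thetaForm_zero_zero (x : ℂ) : thetaForm ![0, 0] x = 0 := by
  simp [thetaForm]

lemma thetaForm_one_zero (x : ℂ) : thetaForm ![1, 0] x = theta1Fourth x + theta3Fourth x := by
  simp [thetaForm]

lemma thetaForm_one_one (x : ℂ) : thetaForm ![1, 1] x = theta2Fourth x - theta1Fourth x := by
  simp [thetaForm]

lemma thetaForm_zero_one (x : ℂ) : thetaForm ![0, 1] x = -(theta2Fourth x + theta3Fourth x) := by
  simp [thetaForm]

lemma zmod_two_vec_cases (v : Fin 2 → ZMod 2) :
    v = ![0, 0] ∨ v = ![1, 0] ∨ v = ![1, 1] ∨ v = ![0, 1] := by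
  revert v
  decide

lemma continuousOn_thetaForm (v : Fin 2 → ZMod 2) :
    ContinuousOn (thetaForm v) (Metric.ball 0 1) := by
  have h1 := differentiableOn_theta1Fourth.continuousOn
  have h2 := differentiableOn_theta2Fourth.continuousOn
  have h3 := differentiableOn_theta3Fourth.continuousOn
  unfold thetaForm
  split_ifs <;> fun_prop

/-- Reduction of an integral matrix modulo `2`. -/
def modTwo (γ : SL(2, ℤ)) : Matrix (Fin 2) (Fin 2) (ZMod 2) :=
  (γ : Matrix (Fin 2) (Fin 2) ℤ).map (Int.castRingHom (ZMod 2))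

lemma modTwo_mul (γ γ' : SL(2, ℤ)) : modTwo (γ * γ') = modTwo γ * modTwo γ' :=
  Matrix.map_mul (f := Int.castRingHom (ZMod 2))

lemma modTwo_one : modTwo 1 = 1 := by
  simp [modTwo]

lemma thetaForm_slash_S (v : Fin 2 → ZMod 2) :
    (fun τ : ℍ ↦ thetaForm v (nome τ)) ∣[(2 : ℤ)] ModularGroup.S =
      fun τ : ℍ ↦ thetaForm (v ᵥ* modTwo ModularGroup.S) (nome τ) := by
  have hS00 : ![0, 0] ᵥ* modTwo ModularGroup.S = ![0, 0] := by decide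
  have hS10 : ![1, 0] ᵥ* modTwo ModularGroup.S = ![0, 1] := by decide
  have hS11 : ![1, 1] ᵥ* modTwo ModularGroup.S = ![1, 1] := by decide
  have hS01 : ![0, 1] ᵥ* modTwo ModularGroup.S = ![1, 0] := by decide
  ext τ
  have hτ : 0 < (τ : ℂ).im := τ.2
  have h0 : (τ : ℂ) ≠ 0 := τ.ne_zero
  have hc : ((UpperHalfPlane.mk (-(τ : ℂ))⁻¹ τ.im_inv_neg_coe_pos : ℍ) : ℂ) = -1 / (τ : ℂ) := by
    simp [neg_div]
  rw [SL_slash_apply, UpperHalfPlane.modular_S_smul, ModularGroup.denom_S, hc,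
    _root_.zpow_neg, zpow_ofNat, ← div_eq_mul_inv, div_eq_iff (pow_ne_zero 2 h0)]
  rcases zmod_two_vec_cases v with rfl | rfl | rfl | rfl <;>
    simp only [hS00, hS10, hS11, hS01, thetaForm_zero_zero, thetaForm_one_zero, thetaForm_one_one,
      thetaForm_zero_one, theta1Fourth_nome_neg_inv hτ, theta2Fourth_nome_neg_inv hτ,
      theta3Fourth_nome_neg_inv hτ] <;>
    ring

lemma thetaForm_slash_T (v : Fin 2 → ZMod 2) :
    (fun τ : ℍ ↦ thetaForm v (nome τ)) ∣[(2 : ℤ)] ModularGroup.T =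
      fun τ : ℍ ↦ thetaForm (v ᵥ* modTwo ModularGroup.T) (nome τ) := by
  have hT00 : ![0, 0] ᵥ* modTwo ModularGroup.T = ![0, 0] := by decide
  have hT10 : ![1, 0] ᵥ* modTwo ModularGroup.T = ![1, 1] := by decide
  have hT11 : ![1, 1] ᵥ* modTwo ModularGroup.T = ![1, 0] := by decide
  have hT01 : ![0, 1] ᵥ* modTwo ModularGroup.T = ![0, 1] := by decide
  ext τ
  have hd : denom (ModularGroup.T : GL (Fin 2) ℝ) τ = 1 := by
    rw [ModularGroup.denom_apply]
    simp [ModularGroup.T]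
  have hc : ((((1 : ℝ) +ᵥ τ : ℍ)) : ℂ) = τ + 1 := by
    simp [add_comm]
  rw [SL_slash_apply, UpperHalfPlane.modular_T_smul, hd, hc, nome_add_one, _root_.one_zpow, mul_one]
  rcases zmod_two_vec_cases v with rfl | rfl | rfl | rfl <;>
    simp only [hT00, hT10, hT11, hT01, thetaForm_zero_zero, thetaForm_one_zero, thetaForm_one_one,
      thetaForm_zero_one, theta1Fourth_neg, theta2Fourth_neg, theta3Fourth_neg] <;>
    ring

lemma thetaForm_slash (γ : SL(2, ℤ)) (v : Fin 2 → ZMod 2) :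
    (fun τ : ℍ ↦ thetaForm v (nome τ)) ∣[(2 : ℤ)] γ =
      fun τ : ℍ ↦ thetaForm (v ᵥ* modTwo γ) (nome τ) := by
  have hγ : γ ∈ Subgroup.closure {ModularGroup.S, ModularGroup.T} := by
    simp [SpecialLinearGroup.SL2Z_generators]
  induction hγ using Subgroup.closure_induction generalizing v with
  | mem γ hγ =>
    rcases hγ with rfl | rfl
    · exact thetaForm_slash_S v
    · exact thetaForm_slash_T v
  | one => simp [modTwo_one]
  | mul γ γ' _ _ h h' => rw [SlashAction.slash_mul, h, h', modTwo_mul, Matrix.vecMul_vecMul]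
  | inv γ _ h =>
    have h1 := h (v ᵥ* modTwo γ⁻¹)
    rw [Matrix.vecMul_vecMul, ← modTwo_mul, inv_mul_cancel, modTwo_one, Matrix.vecMul_one] at h1
    rw [← h1, ← SlashAction.slash_mul, mul_inv_cancel, SlashAction.slash_one]

lemma delta2_eq_thetaForm {τ : ℂ} (hτ : 0 < τ.im) :
    delta2 τ = -(1 / 8) * thetaForm ![1, 0] (nome τ) := by
  rw [delta2_eq hτ, thetaForm_one_zero]

lemma delta2_smul (γ : SL(2, ℤ)) {τ : ℂ} (hτ : 0 < τ.im) :
    (γ 1 0 : ℂ) * τ + (γ 1 1 : ℂ) ≠ 0 ∧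
    delta2 (((γ 0 0 : ℂ) * τ + (γ 0 1 : ℂ)) / ((γ 1 0 : ℂ) * τ + (γ 1 1 : ℂ))) =
      ((γ 1 0 : ℂ) * τ + (γ 1 1 : ℂ)) ^ 2 *
        (-(1 / 8) * thetaForm (![1, 0] ᵥ* modTwo γ) (nome τ)) := by
  have h := congrFun (thetaForm_slash γ ![1, 0]) ⟨τ, hτ⟩
  have hd := UpperHalfPlane.denom_ne_zero (γ : GL (Fin 2) ℝ) ⟨τ, hτ⟩
  rw [ModularGroup.denom_apply] at hd
  have hc := UpperHalfPlane.coe_specialLinearGroup_apply γ ⟨τ, hτ⟩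
  have him : 0 < ((γ • (⟨τ, hτ⟩ : ℍ) : ℍ) : ℂ).im := (γ • (⟨τ, hτ⟩ : ℍ)).2
  rw [SL_slash_apply, ModularGroup.denom_apply] at h
  simp only [algebraMap_int_eq, eq_intCast, Complex.ofReal_intCast] at hc hd h
  refine ⟨hd, ?_⟩
  rw [← hc, delta2_eq_thetaForm him, ← h]
  field_simp

/-- `δ₂` is a modular form of weight 2 over `Γ⁰(2)` (matrices of `SL(2,ℤ)` with upper-right
entry even) with trivial character: it is holomorphic on the upper half-plane, transforms with
weight 2 under `Γ⁰(2)`, and all its weight-2 slash translates are bounded as `Im τ → ∞`. -/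
theorem delta2_modularForm_weight_two_GammaUpper0_two :
    DifferentiableOn ℂ delta2 {τ : ℂ | 0 < τ.im} ∧
    (∀ γ : Matrix.SpecialLinearGroup (Fin 2) ℤ, (γ 0 1 : ZMod 2) = 0 →
      ∀ τ : ℂ, 0 < τ.im →
        delta2 (((γ 0 0 : ℂ) * τ + (γ 0 1 : ℂ)) / ((γ 1 0 : ℂ) * τ + (γ 1 1 : ℂ))) =
          ((γ 1 0 : ℂ) * τ + (γ 1 1 : ℂ)) ^ 2 * delta2 τ) ∧
    (∀ γ : Matrix.SpecialLinearGroup (Fin 2) ℤ, ∃ C A : ℝ, ∀ τ : ℂ, A ≤ τ.im →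
      ‖(((γ 1 0 : ℂ) * τ + (γ 1 1 : ℂ)) ^ 2)⁻¹ *
        delta2 (((γ 0 0 : ℂ) * τ + (γ 0 1 : ℂ)) / ((γ 1 0 : ℂ) * τ + (γ 1 1 : ℂ)))‖ ≤ C) := by
  refine ⟨?_, fun γ hγ τ hτ ↦ ?_, fun γ ↦ ?_⟩
  · have hn : Differentiable ℂ nome := by unfold nome; fun_prop
    have hm : Set.MapsTo nome {τ : ℂ | 0 < τ.im} (Metric.ball 0 1) := fun τ hτ ↦ by
      simpa using norm_nome_lt_one hτ
    exact (((differentiableOn_theta1Fourth.add differentiableOn_theta3Fourth).comp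
      hn.differentiableOn hm).const_mul (-(1 / 8))).congr fun τ hτ ↦ delta2_eq hτ
  · have hdet : (γ 0 0 : ZMod 2) * (γ 1 1 : ZMod 2) = 1 := by
      have h := congrArg (Int.cast : ℤ → ZMod 2) γ.det_coe
      rw [Matrix.det_fin_two] at h
      push_cast at h
      simpa [hγ] using h
    have ha : (γ 0 0 : ZMod 2) = 1 := by
      generalize (γ 0 0 : ZMod 2) = a at hdet
      generalize (γ 1 1 : ZMod 2) = d at hdet
      revert a d
      decide
    have hv : ![1, 0] ᵥ* modTwo γ = ![1, 0] := by
      ext i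
      fin_cases i <;> simp [modTwo, Matrix.vecMul_eq_sum, ha, hγ]
    rw [(delta2_smul γ hτ).2, hv, delta2_eq_thetaForm hτ]
  · have hK : Metric.closedBall (0 : ℂ) (Real.exp (-Real.pi)) ⊆ Metric.ball 0 1 :=
      Metric.closedBall_subset_ball (Real.exp_lt_one_iff.mpr (neg_neg_of_pos Real.pi_pos))
    obtain ⟨C, hC⟩ := (isCompact_closedBall (0 : ℂ) (Real.exp (-Real.pi))).exists_bound_of_continuousOn
      ((continuousOn_thetaForm (![1, 0] ᵥ* modTwo γ)).mono hK)
    refine ⟨1 / 8 * C, 1, fun τ hτ ↦ ?_⟩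
    have hx : nome τ ∈ Metric.closedBall (0 : ℂ) (Real.exp (-Real.pi)) := by
      rw [mem_closedBall_zero_iff, norm_nome, Real.exp_le_exp]
      nlinarith [Real.pi_pos]
    obtain ⟨hd, h⟩ := delta2_smul γ (zero_lt_one.trans_le hτ)
    rw [h, inv_mul_cancel_left₀ (pow_ne_zero 2 hd), norm_mul]
    have := hC _ hx
    norm_num
    linarith
end
end

section
/- For every τ in the upper half-plane ℍ, the derivative of the Jacobi theta function θ at v = 0 satisfies θ'(0, −1/τ) = (τ/i)^{3/2} θ'(0, τ), where (τ/i)^{3/2} denotes the principal branch (note Re(τ/i) > 0 for τ ∈ ℍ). -/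
open Complex

noncomputable section

/-- The `q`-product `∏ (1 - w p ^ (n + 1))` converges for every `w` when `‖p‖ < 1`. -/
lemma multipliable_one_sub_mul_pow {p : ℂ} (hp : ‖p‖ < 1) (w : ℂ) :
    Multipliable fun n : ℕ ↦ 1 - w * p ^ (n + 1) := by
  simp_rw [sub_eq_add_neg]
  apply multipliable_one_add_of_summable
  simpa [norm_mul, norm_pow] using ((summable_nat_add_iff 1).mpr
    (summable_geometric_of_lt_one (norm_nonneg p) hp)).mul_left ‖w‖

/-- The `q`-product `∏ (1 - w p ^ (n + 1))` is continuous in `w` when `‖p‖ < 1`. -/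
lemma continuous_tprod_one_sub_mul_pow {p : ℂ} (hp : ‖p‖ < 1) :
    Continuous fun w : ℂ ↦ ∏' n : ℕ, (1 - w * p ^ (n + 1)) := by
  rw [← continuousOn_univ]
  have h : HasProdLocallyUniformlyOn (fun (n : ℕ) (w : ℂ) ↦ 1 + -(w * p ^ (n + 1)))
      (fun w ↦ ∏' n : ℕ, (1 + -(w * p ^ (n + 1)))) Set.univ := by
    apply hasProdLocallyUniformlyOn_of_forall_compact isOpen_univ
    intro K _ hK
    obtain ⟨R, hR⟩ := hK.isBounded.exists_norm_le
    refine (((summable_nat_add_iff 1).mpr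
      (summable_geometric_of_lt_one (norm_nonneg p) hp)).mul_left R).hasProdUniformlyOn_nat_one_add
      hK (.of_forall fun n w hw ↦ ?_) (fun _ ↦ by fun_prop)
    rw [norm_neg, norm_mul, norm_pow]
    gcongr
    exact hR w hw
  simp_rw [sub_eq_add_neg]
  refine TendstoLocallyUniformlyOn.continuousOn h (.of_forall fun s ↦ ?_)
  fun_prop

/-- The nome `e^{2πiτ}` has norm less than one on the upper half-plane. -/
lemma norm_qpow_one_lt_one {τ : ℂ} (hτ : 0 < τ.im) : ‖qpow 1 τ‖ < 1 := by
  simpa [qpow] using UpperHalfPlane.norm_exp_two_pi_I_lt_one ⟨τ, hτ⟩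

lemma qpow_nat_add_one (j : ℕ) (τ : ℂ) : qpow ((j : ℂ) + 1) τ = qpow 1 τ ^ (j + 1) := by
  rw [qpow, qpow, ← Complex.exp_nat_mul]
  push_cast
  ring_nf

/-- The infinite product of `jTheta` splits into three `q`-products. -/
lemma jTheta_eq_mul_tprod {τ : ℂ} (hτ : 0 < τ.im) (v : ℂ) :
    jTheta v τ = 2 * qpow (1/8) τ * Complex.sin ((Real.pi : ℂ) * v) *
      ((∏' n : ℕ, (1 - 1 * qpow 1 τ ^ (n + 1))) *
        (∏' n : ℕ, (1 - Complex.exp (2 * (Real.pi : ℂ) * Complex.I * v) * qpow 1 τ ^ (n + 1))) *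
        ∏' n : ℕ, (1 - Complex.exp (-(2 * (Real.pi : ℂ) * Complex.I * v)) *
          qpow 1 τ ^ (n + 1))) := by
  have hm := multipliable_one_sub_mul_pow (norm_qpow_one_lt_one hτ)
  simp only [jTheta, qpow_nat_add_one]
  rw [← (hm _).tprod_mul (hm _), ← ((hm _).mul (hm _)).tprod_mul (hm _)]
  simp only [one_mul]

/-- If `f` is differentiable at `x` and vanishes there, and `g` is merely continuous at `x`, then
`f * g` is differentiable at `x`. -/
lemma HasDerivAt.mul_continuousAt_of_eq_zero {f g : ℂ → ℂ} {f' x : ℂ} (hf : HasDerivAt f f' x)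
    (hfx : f x = 0) (hg : ContinuousAt g x) : HasDerivAt (fun v ↦ f v * g v) (f' * g x) x := by
  rw [hasDerivAt_iff_tendsto_slope] at hf ⊢
  refine (hf.mul (hg.mono_left nhdsWithin_le_nhds)).congr fun v ↦ ?_
  simp [slope_def_field, hfx]
  ring

/-- Jacobi's derivative formula in terms of the Dedekind eta function. -/
lemma jThetaDeriv_eq_eta {τ : ℂ} (hτ : 0 < τ.im) :
    jThetaDeriv τ = 2 * (Real.pi : ℂ) * ModularForm.eta τ ^ 3 := by
  have hsin : HasDerivAt (fun v : ℂ ↦ 2 * qpow (1/8) τ * Complex.sin ((Real.pi : ℂ) * v))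
      (2 * qpow (1/8) τ * (Real.pi : ℂ)) 0 := by
    have h : HasDerivAt (fun v : ℂ ↦ (Real.pi : ℂ) * v) (Real.pi : ℂ) 0 := by
      simpa using (hasDerivAt_id (0 : ℂ)).const_mul (Real.pi : ℂ)
    simpa using h.csin.const_mul (2 * qpow (1/8) τ)
  have hc := continuous_tprod_one_sub_mul_pow (norm_qpow_one_lt_one hτ)
  have hd := hsin.mul_continuousAt_of_eq_zero (by simp)
    (((continuous_const (y := ∏' n : ℕ, (1 - 1 * qpow 1 τ ^ (n + 1)))).mul
      (hc.comp (f := fun v ↦ Complex.exp (2 * (Real.pi : ℂ) * Complex.I * v)) (by fun_prop))).mul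
      (hc.comp (f := fun v ↦ Complex.exp (-(2 * (Real.pi : ℂ) * Complex.I * v)))
        (by fun_prop))).continuousAt
  have hq : qpow (1/8) τ = Function.Periodic.qParam 24 τ ^ 3 := by
    rw [qpow, Function.Periodic.qParam, ← Complex.exp_nat_mul]
    push_cast
    ring_nf
  have hp : qpow 1 τ = Function.Periodic.qParam 1 τ := by
    simp [qpow, Function.Periodic.qParam]
  rw [jThetaDeriv, funext (jTheta_eq_mul_tprod hτ)]
  refine hd.deriv.trans ?_
  simp only [Pi.mul_apply, Function.comp_apply, mul_zero, neg_zero, Complex.exp_zero, one_mul, ModularForm.eta,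
    ModularForm.eta_q, hq, hp]
  ring

/-- On the upper half-plane, the principal branch of `(τ / i)^{3/2}` is the cube of the quotient
of the principal square roots. -/
lemma div_I_cpow_three_halves {τ : ℂ} (hτ : 0 < τ.im) :
    (τ / Complex.I) ^ ((3 : ℂ) / 2) = ((Complex.sqrt Complex.I)⁻¹ * Complex.sqrt τ) ^ 3 := by
  have h0 : τ ≠ 0 := by
    rintro rfl
    simp at hτ
  have hlog : Complex.log (τ / Complex.I) = Complex.log τ - Complex.log Complex.I := by
    rw [← Complex.log_exp (x := Complex.log τ - Complex.log Complex.I), Complex.exp_sub,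
      Complex.exp_log h0, Complex.exp_log Complex.I_ne_zero]
    · have := Complex.arg_nonneg_iff.mpr hτ.le
      simp only [Complex.sub_im, Complex.log_im, Complex.arg_I]
      linarith [Real.pi_pos]
    · have := Complex.arg_le_pi τ
      simp only [Complex.sub_im, Complex.log_im, Complex.arg_I]
      linarith [Real.pi_pos]
  rw [Complex.cpow_def_of_ne_zero (div_ne_zero h0 Complex.I_ne_zero), hlog, Complex.sqrt,
    Complex.sqrt, Complex.cpow_def_of_ne_zero Complex.I_ne_zero, Complex.cpow_def_of_ne_zero h0,
    ← Complex.exp_neg, ← Complex.exp_add, ← Complex.exp_nat_mul]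
  push_cast
  ring_nf

/-- The transformation law `θ'(0, -1/τ) = (τ/i)^{3/2} θ'(0, τ)` for `τ` in the upper half-plane,
where `(τ/i)^{3/2}` is the principal branch of the complex power. -/
theorem jThetaDeriv_S_transformation (τ : ℂ) (hτ : 0 < τ.im) :
    jThetaDeriv (-1 / τ) = (τ / Complex.I) ^ ((3 : ℂ) / 2) * jThetaDeriv τ := by
  have hτ' : 0 < (-1 / τ).im := by
    simpa [neg_div] using UpperHalfPlane.im_inv_neg_coe_pos ⟨τ, hτ⟩
  have hη := ModularForm.eta_comp_eq_csqrt_I_inv hτ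
  simp only [Function.comp_apply, Pi.smul_apply, Pi.mul_apply, smul_eq_mul] at hη
  rw [jThetaDeriv_eq_eta hτ', jThetaDeriv_eq_eta hτ, hη, div_I_cpow_three_halves hτ]
  ring
end
end

section
/- Let τ be in the upper half-plane ℍ and v ∈ ℂ be such that θ(v, −1/τ) ≠ 0 and θ(τv, τ) ≠ 0. Then v·θ'(0,−1/τ)·θ₁(v,−1/τ) / (θ(v,−1/τ)·θ₁(0,−1/τ)) = (τv)·θ'(0,τ)·θ₂(τv,τ) / (θ(τv,τ)·θ₂(0,τ)). (This is the transformation law under S: τ ↦ −1/τ of the factor appearing in the characteristic form P₁, relating it to the factor appearing in P₂.) -/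
open Complex

noncomputable section

/-- The infinite `q`-Pochhammer product `∏_{j ≥ 0} (1 + a q^j)`. -/
def qProd (q a : ℂ) : ℂ := ∏' j : ℕ, (1 + a * q ^ j)

/-- The Gaussian binomial coefficient, defined by the `q`-Pascal rule. -/
def qChoose (q : ℂ) : ℕ → ℕ → ℂ
  | _, 0 => 1
  | 0, _ + 1 => 0
  | n + 1, k + 1 => qChoose q n k + q ^ (k + 1) * qChoose q n (k + 1)

lemma qChoose_eq_zero (q : ℂ) {n k : ℕ} (h : n < k) : qChoose q n k = 0 := by
  induction n generalizing k with
  | zero => obtain ⟨k, rfl⟩ := Nat.exists_eq_succ_of_ne_zero h.ne'; rfl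
  | succ n ih =>
    obtain ⟨k, rfl⟩ := Nat.exists_eq_succ_of_ne_zero (Nat.ne_zero_of_lt h)
    simp [qChoose, ih (show n < k by omega), ih (show n < k + 1 by omega)]

lemma qChoose_self (q : ℂ) (n : ℕ) : qChoose q n n = 1 := by
  induction n with
  | zero => rfl
  | succ n ih => simp [qChoose, ih, qChoose_eq_zero]

lemma qChoose_zero_right (q : ℂ) (n : ℕ) : qChoose q n 0 = 1 := by
  cases n <;> rfl

lemma qChoose_add_mul (q : ℂ) (a b : ℕ) :
    qChoose q (a + b) a *
        ((∏ j ∈ Finset.range a, (1 - q ^ (j + 1))) * ∏ j ∈ Finset.range b, (1 - q ^ (j + 1))) =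
      ∏ j ∈ Finset.range (a + b), (1 - q ^ (j + 1)) := by
  induction a generalizing b with
  | zero => simp [qChoose_zero_right]
  | succ a iha =>
    induction b with
    | zero => simp [qChoose_self]
    | succ b ihb =>
      have ha := iha (b + 1)
      rw [show a + (b + 1) = a + 1 + b by ring] at ha
      rw [show a + 1 + (b + 1) = (a + 1 + b) + 1 by ring, qChoose,
        Finset.prod_range_succ _ (a + 1 + b)]
      calc _ = (1 - q ^ (a + 1)) * (qChoose q (a + 1 + b) a *
            ((∏ j ∈ Finset.range a, (1 - q ^ (j + 1))) *
              ∏ j ∈ Finset.range (b + 1), (1 - q ^ (j + 1)))) +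
            q ^ (a + 1) * (1 - q ^ (b + 1)) * (qChoose q (a + 1 + b) (a + 1) *
            ((∏ j ∈ Finset.range (a + 1), (1 - q ^ (j + 1))) *
              ∏ j ∈ Finset.range b, (1 - q ^ (j + 1)))) := by
              rw [Finset.prod_range_succ _ a, Finset.prod_range_succ _ b]; ring
        _ = _ := by rw [ha, ihb]; ring

/-- The `q`-binomial theorem. -/
lemma prod_one_add_mul_pow (q y : ℂ) (n : ℕ) :
    ∏ j ∈ Finset.range n, (1 + y * q ^ j) =
      ∑ k ∈ Finset.range (n + 1), qChoose q n k * q ^ k.choose 2 * y ^ k := by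
  induction n generalizing y with
  | zero => simp [qChoose]
  | succ n ih =>
    have h : ∏ j ∈ Finset.range n, (1 + y * q ^ (j + 1)) =
        ∑ k ∈ Finset.range (n + 1), qChoose q n k * q ^ k.choose 2 * (y * q) ^ k := by
      rw [← ih (y * q)]
      exact Finset.prod_congr rfl fun j _ => by ring
    have h' : ∑ k ∈ Finset.range (n + 1), qChoose q n k * q ^ k.choose 2 * (y * q) ^ k =
        ∑ k ∈ Finset.range (n + 1),
          qChoose q n (k + 1) * q ^ (k + 1).choose 2 * (y * q) ^ (k + 1) + 1 := by
      rw [Finset.sum_range_succ', Finset.sum_range_succ _ n, qChoose_eq_zero q (Nat.lt_succ_self n)]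
      simp [qChoose_zero_right]
    rw [Finset.prod_range_succ', h, mul_comm, add_mul, Finset.sum_range_succ' _ (n + 1)]
    nth_rw 1 [h']
    simp only [pow_zero, mul_one, one_mul, Finset.mul_sum, qChoose_zero_right, Nat.choose_zero_succ]
    rw [add_right_comm, ← Finset.sum_add_distrib]
    congr 1
    refine Finset.sum_congr rfl fun k _ => ?_
    rw [qChoose, Nat.choose_succ_succ' k 1, Nat.choose_one_right]
    ring

/-- The finite form of the Jacobi triple product. -/
lemma finite_triple_product {x w : ℂ} (hx : x ≠ 0) (hw : w ≠ 0) (n : ℕ) :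
    (∏ j ∈ Finset.range n, (1 + w * x * (x ^ 2) ^ j)) *
        ∏ j ∈ Finset.range n, (1 + w⁻¹ * x * (x ^ 2) ^ j) =
      ∑ k ∈ Finset.range (2 * n + 1), qChoose (x ^ 2) (2 * n) k *
        (x ^ (((k : ℤ) - n) ^ 2) * w ^ ((k : ℤ) - n)) := by
  have hq := prod_one_add_mul_pow (x ^ 2) (w * x ^ (1 - 2 * n : ℤ)) (2 * n)
  have hsplit : ∏ j ∈ Finset.range (2 * n), (1 + w * x ^ (1 - 2 * n : ℤ) * (x ^ 2) ^ j) =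
      (w ^ n * x ^ (-(n : ℤ) ^ 2)) * ((∏ j ∈ Finset.range n, (1 + w * x * (x ^ 2) ^ j)) *
        ∏ j ∈ Finset.range n, (1 + w⁻¹ * x * (x ^ 2) ^ j)) := by
    have hfirst : ∏ j ∈ Finset.range n, (1 + w * x ^ (1 - 2 * n : ℤ) * (x ^ 2) ^ j) =
        ∏ j ∈ Finset.range n, (w * x ^ (-(2 * j + 1) : ℤ) * (1 + w⁻¹ * x * (x ^ 2) ^ j)) := by
      rw [← Finset.prod_range_reflect]
      refine Finset.prod_congr rfl fun j hj => ?_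
      have hj := Finset.mem_range.mp hj
      have e1 : x ^ (1 - 2 * n : ℤ) * (x ^ 2) ^ (n - 1 - j) = x ^ (-(2 * j + 1) : ℤ) := by
        rw [← pow_mul, ← zpow_natCast, ← zpow_add₀ hx]
        congr 1
        omega
      have e2 : x ^ (-(2 * j + 1) : ℤ) * (x * (x ^ 2) ^ j) = 1 := by
        rw [← pow_mul, ← pow_succ', ← zpow_natCast, ← zpow_add₀ hx]
        simp
      rw [mul_assoc, e1]
      linear_combination -(w * w⁻¹) * e2 - mul_inv_cancel₀ hw
    have hprod : ∏ j ∈ Finset.range n, (w * x ^ (-(2 * j + 1) : ℤ)) =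
        w ^ n * x ^ (-(n : ℤ) ^ 2) := by
      clear hq hfirst
      induction n with
      | zero => simp
      | succ n ih =>
        rw [Finset.prod_range_succ, ih, show (-((n + 1 : ℕ) : ℤ) ^ 2) =
          -(n : ℤ) ^ 2 + (-(2 * n + 1)) by push_cast; ring, zpow_add₀ hx]
        ring
    have hsecond : ∏ j ∈ Finset.range n, (1 + w * x ^ (1 - 2 * n : ℤ) * (x ^ 2) ^ (n + j)) =
        ∏ j ∈ Finset.range n, (1 + w * x * (x ^ 2) ^ j) := by
      refine Finset.prod_congr rfl fun j _ => ?_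
      have : x ^ (1 - 2 * n : ℤ) * (x ^ 2) ^ n = x := by
        rw [← pow_mul, ← zpow_natCast, ← zpow_add₀ hx]
        simp
      rw [pow_add]
      linear_combination w * (x ^ 2) ^ j * this
    rw [show Finset.range (2 * n) = Finset.range (n + n) by rw [two_mul], Finset.prod_range_add,
      hfirst, hsecond, Finset.prod_mul_distrib,
      hprod]
    ring
  rw [hsplit] at hq
  have hne : w ^ n * x ^ (-(n : ℤ) ^ 2) ≠ 0 := by positivity
  refine mul_left_cancel₀ hne (hq.trans ?_)
  rw [Finset.mul_sum]
  refine Finset.sum_congr rfl fun k _ => ?_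
  have e1 : (x ^ 2) ^ k.choose 2 * (x ^ (1 - 2 * n : ℤ)) ^ k =
      x ^ (-(n : ℤ) ^ 2) * x ^ (((k : ℤ) - n) ^ 2) := by
    have hc : (2 * k.choose 2 : ℤ) = k * (k - 1) := by
      rcases k with _ | k
      · simp
      · rw [Nat.choose_two_right]
        have := Nat.div_mul_cancel (Nat.even_mul_pred_self (k + 1)).two_dvd
        simp only [Nat.add_sub_cancel] at this ⊢
        push_cast [← Int.natCast_inj] at this ⊢
        linarith
    rw [← pow_mul, ← zpow_natCast, ← zpow_natCast, ← zpow_mul, ← zpow_add₀ hx, ← zpow_add₀ hx]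
    congr 1
    push_cast
    rw [hc]
    ring
  have e2 : w ^ n * w ^ ((k : ℤ) - n) = w ^ k := by
    rw [← zpow_natCast, ← zpow_add₀ hw, ← zpow_natCast]
    congr 1
    ring
  rw [mul_pow, ← e2]
  generalize x ^ (((k : ℤ) - n) ^ 2) = X at e1 ⊢
  generalize x ^ (-(n : ℤ) ^ 2) = Y at e1 ⊢
  generalize (x ^ (1 - 2 * n : ℤ)) ^ k = Z at e1 ⊢
  generalize w ^ ((k : ℤ) - n) = W
  linear_combination qChoose (x ^ 2) (2 * n) k * w ^ n * W * e1

lemma multipliable_qProd {q : ℂ} (hq : ‖q‖ < 1) (a : ℂ) :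
    Multipliable fun j : ℕ => 1 + a * q ^ j := by
  apply multipliable_one_add_of_summable
  simpa using (summable_geometric_of_lt_one (norm_nonneg _) hq).mul_left ‖a‖

lemma qProd_eq_mul {q : ℂ} (hq : ‖q‖ < 1) (a : ℂ) : qProd q a = (1 + a) * qProd q (a * q) := by
  have h : (fun j : ℕ => 1 + a * q ^ (j + 1)) = fun j : ℕ => 1 + a * q * q ^ j := by
    ext j
    ring
  rw [qProd, tprod_eq_zero_mul' (h ▸ multipliable_qProd hq (a * q)), h, pow_zero, mul_one, qProd]

lemma tendsto_qProd {q : ℂ} (hq : ‖q‖ < 1) (a : ℂ) :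
    Filter.Tendsto (fun n => ∏ j ∈ Finset.range n, (1 + a * q ^ j)) Filter.atTop
      (nhds (qProd q a)) :=
  (multipliable_qProd hq a).hasProd.tendsto_prod_nat

lemma one_sub_pow_ne_zero {q : ℂ} (hq : ‖q‖ < 1) (j : ℕ) : 1 - q ^ (j + 1) ≠ 0 := by
  intro h
  have : ‖q ^ (j + 1)‖ < 1 := by
    rw [norm_pow]
    exact pow_lt_one₀ (norm_nonneg _) hq (Nat.succ_ne_zero j)
  rw [← sub_eq_zero.mp h] at this
  simp at this

lemma qProd_neg_self_ne_zero {q : ℂ} (hq : ‖q‖ < 1) : qProd q (-q) ≠ 0 := by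
  refine tprod_one_add_ne_zero_of_summable (fun j => ?_) ?_
  · convert one_sub_pow_ne_zero hq j using 1
    ring
  · simpa using (summable_geometric_of_lt_one (norm_nonneg _) hq).mul_left ‖q‖

lemma tendsto_prod_one_sub_pow {q : ℂ} (hq : ‖q‖ < 1) :
    Filter.Tendsto (fun n => ∏ j ∈ Finset.range n, (1 - q ^ (j + 1))) Filter.atTop
      (nhds (qProd q (-q))) := by
  refine (tendsto_qProd hq (-q)).congr fun n => Finset.prod_congr rfl fun j _ => ?_
  ring

lemma qChoose_add_eq_div {q : ℂ} (hq : ‖q‖ < 1) (a b : ℕ) :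
    qChoose q (a + b) a = (∏ j ∈ Finset.range (a + b), (1 - q ^ (j + 1))) *
      ((∏ j ∈ Finset.range a, (1 - q ^ (j + 1)))⁻¹ *
        (∏ j ∈ Finset.range b, (1 - q ^ (j + 1)))⁻¹) := by
  rw [← qChoose_add_mul]
  have h (n : ℕ) : ∏ j ∈ Finset.range n, (1 - q ^ (j + 1)) ≠ 0 :=
    Finset.prod_ne_zero_iff.mpr fun j _ => one_sub_pow_ne_zero hq j
  have := h a
  have := h b
  field_simp

lemma exists_norm_qChoose_le {q : ℂ} (hq : ‖q‖ < 1) : ∃ B, ∀ n k, ‖qChoose q n k‖ ≤ B := by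
  have ht := tendsto_prod_one_sub_pow hq
  obtain ⟨M, hM⟩ := (Metric.isBounded_range_of_tendsto _ ht).exists_norm_le
  obtain ⟨N, hN⟩ := (Metric.isBounded_range_of_tendsto _
    (ht.inv₀ (qProd_neg_self_ne_zero hq))).exists_norm_le
  have hM0 : 0 ≤ M := (norm_nonneg _).trans (hM _ ⟨0, rfl⟩)
  have hN0 : 0 ≤ N := (norm_nonneg _).trans (hN _ ⟨0, rfl⟩)
  refine ⟨M * (N * N), fun n k => ?_⟩
  rcases lt_or_ge n k with h | h
  · rw [qChoose_eq_zero q h, norm_zero]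
    positivity
  · obtain ⟨b, rfl⟩ := Nat.exists_eq_add_of_le h
    rw [qChoose_add_eq_div hq, norm_mul, norm_mul]
    gcongr
    · exact hM _ ⟨k + b, rfl⟩
    · exact hN _ ⟨k, rfl⟩
    · exact hN _ ⟨b, rfl⟩

lemma tendsto_qChoose_central {q : ℂ} (hq : ‖q‖ < 1) (k : ℤ) :
    Filter.Tendsto (fun n : ℕ => qChoose q (2 * n) (k + n).toNat) Filter.atTop
      (nhds (qProd q (-q))⁻¹) := by
  have ht := tendsto_prod_one_sub_pow hq
  have h0 := qProd_neg_self_ne_zero hq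
  have hi := ht.inv₀ h0
  have a1 : Filter.Tendsto (fun n : ℕ => (k + n).toNat) Filter.atTop Filter.atTop :=
    Filter.tendsto_atTop.mpr fun b => Filter.eventually_atTop.mpr
      ⟨k.natAbs + b, fun n hn => by omega⟩
  have a2 : Filter.Tendsto (fun n : ℕ => (n - k).toNat) Filter.atTop Filter.atTop :=
    Filter.tendsto_atTop.mpr fun b => Filter.eventually_atTop.mpr
      ⟨k.natAbs + b, fun n hn => by omega⟩
  have a3 : Filter.Tendsto (fun n : ℕ => 2 * n) Filter.atTop Filter.atTop :=
    Filter.tendsto_atTop.mpr fun b => Filter.eventually_atTop.mpr ⟨b, fun n hn => by omega⟩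
  have hlim := (ht.comp a3).mul ((hi.comp a1).mul (hi.comp a2))
  rw [mul_inv_cancel_left₀ h0] at hlim
  refine hlim.congr' (Filter.eventually_atTop.mpr ⟨k.natAbs, fun n hn => ?_⟩)
  have hs : 2 * n = (k + n).toNat + (n - k).toNat := by omega
  simp only [Function.comp]
  rw [hs, qChoose_add_eq_div hq]

lemma norm_exp_pi_I_mul_lt_one {τ : ℂ} (hτ : 0 < τ.im) : ‖cexp (Real.pi * I * τ)‖ < 1 := by
  rw [Complex.norm_exp, Real.exp_lt_one_iff]
  simpa using mul_pos Real.pi_pos hτ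

/-- The Jacobi triple product identity. -/
lemma jacobiTheta₂_eq_qProd {τ : ℂ} (hτ : 0 < τ.im) (z : ℂ) :
    jacobiTheta₂ z τ = qProd (cexp (Real.pi * I * τ) ^ 2) (-cexp (Real.pi * I * τ) ^ 2) *
      (qProd (cexp (Real.pi * I * τ) ^ 2)
          (cexp (2 * Real.pi * I * z) * cexp (Real.pi * I * τ)) *
        qProd (cexp (Real.pi * I * τ) ^ 2)
          ((cexp (2 * Real.pi * I * z))⁻¹ * cexp (Real.pi * I * τ))) := by
  set x := cexp (Real.pi * I * τ) with hxdef
  set w := cexp (2 * Real.pi * I * z) with hwdef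
  have hx : x ≠ 0 := Complex.exp_ne_zero _
  have hw : w ≠ 0 := Complex.exp_ne_zero _
  have hq : ‖x ^ 2‖ < 1 := by
    rw [norm_pow]
    exact pow_lt_one₀ (norm_nonneg _) (norm_exp_pi_I_mul_lt_one hτ) two_ne_zero
  have hterm (k : ℤ) : jacobiTheta₂_term k z τ = x ^ (k ^ 2) * w ^ k := by
    rw [jacobiTheta₂_term, hxdef, hwdef, ← Complex.exp_int_mul, ← Complex.exp_int_mul,
      ← Complex.exp_add]
    push_cast
    ring_nf
  obtain ⟨B, hB⟩ := exists_norm_qChoose_le hq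
  have hsum := (summable_jacobiTheta₂_term_iff z τ).mpr hτ
  let F (n : ℕ) (k : ℤ) : ℂ :=
    if -(n : ℤ) ≤ k then qChoose (x ^ 2) (2 * n) (k + n).toNat * jacobiTheta₂_term k z τ else 0
  have hF (n : ℕ) : ∑' k, F n k = (∏ j ∈ Finset.range n, (1 + w * x * (x ^ 2) ^ j)) *
        ∏ j ∈ Finset.range n, (1 + w⁻¹ * x * (x ^ 2) ^ j) := by
    rw [finite_triple_product hx hw, tsum_eq_sum (s := Finset.Icc (-(n : ℤ)) n)]
    · refine Finset.sum_bij' (fun k _ => (k + n).toNat) (fun k _ => (k : ℤ) - n) ?_ ?_ ?_ ?_ ?_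
      · intro k hk
        simp only [Finset.mem_Icc, Finset.mem_range] at hk ⊢
        omega
      · intro k hk
        simp only [Finset.mem_Icc, Finset.mem_range] at hk ⊢
        omega
      · intro k hk
        simp only [Finset.mem_Icc] at hk
        omega
      · intro k hk
        omega
      · intro k hk
        simp only [Finset.mem_Icc] at hk
        have : (((k + n).toNat : ℕ) : ℤ) - n = k := by omega
        rw [this, ← hterm]
        exact if_pos hk.1
    · intro k hk
      simp only [Finset.mem_Icc, not_and, not_le] at hk
      by_cases h : -(n : ℤ) ≤ k
      · have := hk h
        simp only [F, if_pos h]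
        rw [qChoose_eq_zero _ (by omega), zero_mul]
      · exact if_neg h
  have hlim : Filter.Tendsto (fun n => ∑' k, F n k) Filter.atTop
      (nhds (∑' k, (qProd (x ^ 2) (-x ^ 2))⁻¹ * jacobiTheta₂_term k z τ)) := by
    refine tendsto_tsum_of_dominated_convergence (hsum.norm.mul_left B) (fun k => ?_)
      (Filter.Eventually.of_forall fun n k => ?_)
    · refine ((tendsto_qChoose_central hq k).mul_const _).congr'
        (Filter.eventually_atTop.mpr ⟨k.natAbs, fun n hn => ?_⟩)
      exact (if_pos (by omega)).symm
    · simp only [F]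
      split_ifs
      · rw [norm_mul]
        gcongr
        exact hB _ _
      · rw [norm_zero]
        exact mul_nonneg ((norm_nonneg _).trans (hB 0 0)) (norm_nonneg _)
  simp only [hF] at hlim
  have := tendsto_nhds_unique hlim ((tendsto_qProd hq _).mul (tendsto_qProd hq _))
  rw [← this, tsum_mul_left, mul_inv_cancel_left₀ (qProd_neg_self_ne_zero hq), jacobiTheta₂]

lemma qpow_eq_mul {τ : ℂ} (s : ℂ) (j : ℕ) :
    qpow (j + s) τ = qpow s τ * (cexp (Real.pi * I * τ) ^ 2) ^ j := by
  rw [qpow, qpow, ← pow_mul, ← Complex.exp_nat_mul, ← Complex.exp_add]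
  push_cast
  ring_nf

lemma qpow_one (τ : ℂ) : qpow 1 τ = cexp (Real.pi * I * τ) ^ 2 := by
  rw [qpow, ← Complex.exp_nat_mul]
  push_cast
  ring_nf

lemma qpow_half (τ : ℂ) : qpow (1 / 2) τ = cexp (Real.pi * I * τ) := by
  rw [qpow]
  ring_nf

lemma tprod_eq_qProd {τ : ℂ} (hτ : 0 < τ.im) (s w w' : ℂ) :
    ∏' j : ℕ, ((1 - qpow ((j : ℂ) + 1) τ) * (1 + w * qpow ((j : ℂ) + s) τ) *
        (1 + w' * qpow ((j : ℂ) + s) τ)) =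
      qProd (cexp (Real.pi * I * τ) ^ 2) (-cexp (Real.pi * I * τ) ^ 2) *
        (qProd (cexp (Real.pi * I * τ) ^ 2) (w * qpow s τ) *
          qProd (cexp (Real.pi * I * τ) ^ 2) (w' * qpow s τ)) := by
  have hq : ‖cexp (Real.pi * I * τ) ^ 2‖ < 1 := by
    rw [norm_pow]
    exact pow_lt_one₀ (norm_nonneg _) (norm_exp_pi_I_mul_lt_one hτ) two_ne_zero
  have h := multipliable_qProd hq
  rw [qProd, qProd, qProd, ← (h _).tprod_mul (h _), ← (h _).tprod_mul ((h _).mul (h _))]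
  refine tprod_congr fun j => ?_
  rw [qpow_eq_mul s, qpow_eq_mul 1, qpow_one]
  ring

lemma jTheta2_eq_jacobiTheta₂ {τ : ℂ} (hτ : 0 < τ.im) (v : ℂ) :
    jTheta2 v τ = jacobiTheta₂ (v + 1 / 2) τ := by
  have e : cexp (2 * Real.pi * I * (v + 1 / 2)) = -cexp (2 * Real.pi * I * v) := by
    rw [show 2 * Real.pi * I * (v + 1 / 2) = 2 * Real.pi * I * v + Real.pi * I by ring,
      Complex.exp_add, Complex.exp_pi_mul_I]
    ring
  have := tprod_eq_qProd hτ (1 / 2) (-cexp (2 * Real.pi * I * v)) (-cexp (-(2 * Real.pi * I * v)))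
  rw [jacobiTheta₂_eq_qProd hτ, e, inv_neg, ← Complex.exp_neg, jTheta2]
  rw [qpow_half] at this
  rw [← this]
  simp only [neg_mul, sub_eq_add_neg]

lemma jTheta1_eq_jacobiTheta₂ {τ : ℂ} (hτ : 0 < τ.im) (v : ℂ) :
    jTheta1 v τ = qpow (1 / 8) τ * cexp (Real.pi * I * v) * jacobiTheta₂ (v + τ / 2) τ := by
  have hq : ‖cexp (Real.pi * I * τ) ^ 2‖ < 1 := by
    rw [norm_pow]
    exact pow_lt_one₀ (norm_nonneg _) (norm_exp_pi_I_mul_lt_one hτ) two_ne_zero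
  have e : cexp (2 * Real.pi * I * (v + τ / 2)) =
      cexp (2 * Real.pi * I * v) * cexp (Real.pi * I * τ) := by
    rw [← Complex.exp_add]
    ring_nf
  have hc : 2 * Complex.cos (Real.pi * v) =
      cexp (Real.pi * I * v) * (1 + cexp (-(2 * Real.pi * I * v))) := by
    rw [Complex.two_cos, mul_add, ← Complex.exp_add]
    ring_nf
  have hx := Complex.exp_ne_zero (Real.pi * I * τ)
  rw [jTheta1, tprod_eq_qProd hτ, jacobiTheta₂_eq_qProd hτ, e, mul_inv, mul_assoc _ _⁻¹,
    inv_mul_cancel₀ hx, mul_one, qProd_eq_mul hq (_)⁻¹, ← Complex.exp_neg, qpow_one, pow_two,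
    mul_right_comm 2, hc]
  ring_nf

lemma jTheta_eq_jTheta1 (v τ : ℂ) : jTheta v τ = jTheta1 (v - 1 / 2) τ := by
  have e : cexp (2 * Real.pi * I * (v - 1 / 2)) = -cexp (2 * Real.pi * I * v) := by
    rw [show 2 * Real.pi * I * (v - 1 / 2) = 2 * Real.pi * I * v - Real.pi * I by ring,
      Complex.exp_sub, Complex.exp_pi_mul_I]
    ring
  have hc : Complex.cos (Real.pi * (v - 1 / 2)) = Complex.sin (Real.pi * v) := by
    rw [← Complex.cos_sub_pi_div_two]
    ring_nf
  rw [jTheta, jTheta1, hc, Complex.exp_neg, Complex.exp_neg, e, inv_neg]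
  simp only [neg_mul, sub_eq_add_neg]

lemma jTheta1_neg (v τ : ℂ) : jTheta1 (-v) τ = jTheta1 v τ := by
  simp only [jTheta1, mul_neg, Complex.cos_neg, neg_neg]
  congr 1
  refine tprod_congr fun j => ?_
  ring

lemma jTheta_zero (τ : ℂ) : jTheta 0 τ = 0 := by
  simp [jTheta]

lemma im_neg_one_div_pos_s8 {τ : ℂ} (hτ : 0 < τ.im) : 0 < (-1 / τ).im := by
  have : τ ≠ 0 := fun h => by simp [h] at hτ
  rw [neg_div, one_div, neg_im, inv_im, neg_div, neg_neg]
  exact div_pos hτ (normSq_pos.mpr this)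

lemma differentiable_jTheta {τ : ℂ} (hτ : 0 < τ.im) : Differentiable ℂ fun v => jTheta v τ := by
  have h : Differentiable ℂ (jacobiTheta₂ · τ) := fun z => differentiableAt_jacobiTheta₂_fst z hτ
  simp only [jTheta_eq_jTheta1, jTheta1_eq_jacobiTheta₂ hτ]
  have h' : Differentiable ℂ fun v : ℂ => jacobiTheta₂ (v - 1 / 2 + τ / 2) τ :=
    h.comp (by fun_prop)
  fun_prop

lemma exists_jTheta2_mul {τ : ℂ} (hτ : 0 < τ.im) : ∃ K : ℂ, K ≠ 0 ∧ ∀ v,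
    jTheta2 (τ * v) τ = K * cexp (-(Real.pi : ℂ) * I * τ * v ^ 2) * jTheta1 v (-1 / τ) := by
  have hτ0 : τ ≠ 0 := fun h => by simp [h] at hτ
  have hτ' := im_neg_one_div_pos_s8 hτ
  refine ⟨1 / (-I * τ) ^ (1 / 2 : ℂ), ?_, fun v => ?_⟩
  · simp [Complex.cpow_eq_zero_iff, hτ0]
  · rw [jTheta2_eq_jacobiTheta₂ hτ, jacobiTheta₂_functional_equation, ← jTheta1_neg,
      jTheta1_eq_jacobiTheta₂ hτ', ← jacobiTheta₂_neg_left]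
    have e1 : -((τ * v + 1 / 2) / τ) = -v + -1 / τ / 2 := by field_simp; ring
    have e2 : cexp (-Real.pi * I * (τ * v + 1 / 2) ^ 2 / τ) =
        cexp (-(Real.pi : ℂ) * I * τ * v ^ 2) *
          (qpow (1 / 8) (-1 / τ) * cexp (Real.pi * I * -v)) := by
      rw [qpow, ← Complex.exp_add, ← Complex.exp_add]
      congr 1
      field_simp
      ring
    rw [e1, e2]
    ring

lemma exists_jTheta_mul {τ : ℂ} (hτ : 0 < τ.im) : ∃ C : ℂ, C ≠ 0 ∧ ∀ v,
    jTheta (τ * v) τ = C * cexp (-(Real.pi : ℂ) * I * τ * v ^ 2) * jTheta v (-1 / τ) := by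
  have hτ0 : τ ≠ 0 := fun h => by simp [h] at hτ
  have hτ' := im_neg_one_div_pos_s8 hτ
  refine ⟨1 / (-I * τ) ^ (1 / 2 : ℂ) * cexp (Real.pi * I / 2), ?_, fun v => ?_⟩
  · simp [Complex.cpow_eq_zero_iff, hτ0]
  · have e1 : (τ * v - 1 / 2 + τ / 2) / τ = v - 1 / 2 + -1 / τ / 2 + 1 := by field_simp; ring
    have e2 : qpow (1 / 8) τ * cexp (Real.pi * I * (τ * v - 1 / 2)) *
          cexp (-Real.pi * I * (τ * v - 1 / 2 + τ / 2) ^ 2 / τ) =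
        cexp (Real.pi * I / 2) * cexp (-(Real.pi : ℂ) * I * τ * v ^ 2) *
          (qpow (1 / 8) (-1 / τ) * cexp (Real.pi * I * (v - 1 / 2))) := by
      simp only [qpow, ← Complex.exp_add]
      congr 1
      field_simp
      ring
    rw [jTheta_eq_jTheta1, jTheta_eq_jTheta1, jTheta1_eq_jacobiTheta₂ hτ,
      jacobiTheta₂_functional_equation, jTheta1_eq_jacobiTheta₂ hτ', e1, jacobiTheta₂_add_left]
    linear_combination (1 / (-I * τ) ^ (1 / 2 : ℂ) *
      jacobiTheta₂ (v - 1 / 2 + -1 / τ / 2) (-1 / τ)) * e2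

lemma jThetaDeriv_S {τ C : ℂ} (hτ : 0 < τ.im) (h : ∀ v,
    jTheta (τ * v) τ = C * cexp (-(Real.pi : ℂ) * I * τ * v ^ 2) * jTheta v (-1 / τ)) :
    τ * jThetaDeriv τ = C * jThetaDeriv (-1 / τ) := by
  have hl : HasDerivAt (fun v => jTheta (τ * v) τ) (jThetaDeriv τ * τ) 0 := by
    have h1 : HasDerivAt (fun v => jTheta v τ) (jThetaDeriv τ) (τ * 0) := by
      rw [mul_zero]
      exact (differentiable_jTheta hτ 0).hasDerivAt
    simpa [Function.comp_def] using h1.comp 0 ((hasDerivAt_id (0 : ℂ)).const_mul τ)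
  have hE : DifferentiableAt ℂ (fun v : ℂ => C * cexp (-(Real.pi : ℂ) * I * τ * v ^ 2)) 0 := by
    fun_prop
  have hr := hE.hasDerivAt.mul
    (differentiable_jTheta (im_neg_one_div_pos_s8 hτ) 0).hasDerivAt
  have := (hl.congr_of_eventuallyEq (Filter.Eventually.of_forall fun v => (h v).symm)).unique hr
  simp only [jTheta_zero, mul_zero, zero_add, ne_eq, OfNat.ofNat_ne_zero, not_false_eq_true,
    zero_pow, Complex.exp_zero, mul_one] at this
  rw [mul_comm, this, jThetaDeriv]

/-- Transformation under `S : τ ↦ -1/τ` of the factor appearing in the characteristic form `P₁`: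
`v θ'(0,-1/τ) θ₁(v,-1/τ) / (θ(v,-1/τ) θ₁(0,-1/τ)) = (τv) θ'(0,τ) θ₂(τv,τ) / (θ(τv,τ) θ₂(0,τ))`. -/
theorem P1_factor_S_transformation (τ : ℂ) (hτ : 0 < τ.im) (v : ℂ)
    (h1 : jTheta v (-1 / τ) ≠ 0) (h2 : jTheta (τ * v) τ ≠ 0) :
    v * jThetaDeriv (-1 / τ) * jTheta1 v (-1 / τ) /
        (jTheta v (-1 / τ) * jTheta1 0 (-1 / τ)) =
      (τ * v) * jThetaDeriv τ * jTheta2 (τ * v) τ /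
        (jTheta (τ * v) τ * jTheta2 0 τ) := by
  obtain ⟨K, hK, hθ⟩ := exists_jTheta2_mul hτ
  obtain ⟨C, hC, h0⟩ := exists_jTheta_mul hτ
  have hd := jThetaDeriv_S hτ h0
  rw [h0]
  have e0 := hθ 0
  simp only [mul_zero, ne_eq, OfNat.ofNat_ne_zero, not_false_eq_true, zero_pow,
    Complex.exp_zero, mul_one] at e0
  rw [hθ, e0, show τ * v * jThetaDeriv τ = v * (τ * jThetaDeriv τ) by ring, hd]
  by_cases h10 : jTheta1 0 (-1 / τ) = 0
  · simp [h10]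
  have hE := Complex.exp_ne_zero (-(Real.pi : ℂ) * I * τ * v ^ 2)
  field_simp
end
end

section
/- Let τ be in the upper half-plane ℍ and v ∈ ℂ be such that θ(v, τ+1) ≠ 0 and θ(v, τ) ≠ 0. Then v·θ'(0,τ+1)·θ₁(v,τ+1) / (θ(v,τ+1)·θ₁(0,τ+1)) = v·θ'(0,τ)·θ₁(v,τ) / (θ(v,τ)·θ₁(0,τ)). (This is the invariance under T: τ ↦ τ+1 of the factor appearing in the characteristic form P₁.) -/
open Complex

noncomputable section

theorem qpow_add_one (s τ : ℂ) :
    qpow s (τ + 1) = Complex.exp (2 * (Real.pi : ℂ) * Complex.I * s) * qpow s τ := by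
  unfold qpow
  rw [← Complex.exp_add]
  ring_nf

theorem qpow_natCast_succ_add_one (j : ℕ) (τ : ℂ) :
    qpow ((j : ℂ) + 1) (τ + 1) = qpow ((j : ℂ) + 1) τ := by
  have h := Complex.exp_nat_mul_two_pi_mul_I (j + 1)
  push_cast at h
  rw [qpow_add_one, mul_comm (2 * (Real.pi : ℂ) * Complex.I), h, one_mul]

theorem jTheta_add_one (v τ : ℂ) :
    jTheta v (τ + 1) =
      Complex.exp (2 * (Real.pi : ℂ) * Complex.I * (1 / 8)) * jTheta v τ := by
  simp only [jTheta, qpow_natCast_succ_add_one]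
  rw [qpow_add_one]
  ring

theorem jTheta1_add_one (v τ : ℂ) :
    jTheta1 v (τ + 1) =
      Complex.exp (2 * (Real.pi : ℂ) * Complex.I * (1 / 8)) * jTheta1 v τ := by
  simp only [jTheta1, qpow_natCast_succ_add_one]
  rw [qpow_add_one]
  ring

theorem jThetaDeriv_add_one (τ : ℂ) :
    jThetaDeriv (τ + 1) =
      Complex.exp (2 * (Real.pi : ℂ) * Complex.I * (1 / 8)) * jThetaDeriv τ := by
  simp only [jThetaDeriv, jTheta_add_one]
  exact deriv_const_mul_field _

/-- Invariance under `T : τ ↦ τ + 1` of the factor appearing in the characteristic form `P₁`: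
`v θ'(0,τ+1) θ₁(v,τ+1) / (θ(v,τ+1) θ₁(0,τ+1)) = v θ'(0,τ) θ₁(v,τ) / (θ(v,τ) θ₁(0,τ))`. -/
theorem P1_factor_T_invariance (τ : ℂ) (hτ : 0 < τ.im) (v : ℂ)
    (h1 : jTheta v (τ + 1) ≠ 0) (h2 : jTheta v τ ≠ 0) :
    v * jThetaDeriv (τ + 1) * jTheta1 v (τ + 1) /
        (jTheta v (τ + 1) * jTheta1 0 (τ + 1)) =
      v * jThetaDeriv τ * jTheta1 v τ / (jTheta v τ * jTheta1 0 τ) := by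
  rw [jThetaDeriv_add_one, jTheta1_add_one, jTheta1_add_one, jTheta_add_one]
  set c := Complex.exp (2 * (Real.pi : ℂ) * Complex.I * (1 / 8))
  have hc0 : c * c ≠ 0 := mul_ne_zero (Complex.exp_ne_zero _) (Complex.exp_ne_zero _)
  rw [← mul_div_mul_left (v * jThetaDeriv τ * jTheta1 v τ) (jTheta v τ * jTheta1 0 τ) hc0]
  congr 1 <;> ring
end
end
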